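/- Let K be a scattered locally compact Hausdorff space and let X be a finite dimensional Banach space. Then C_0(K,X) has property CWO-B, i.e., for every finite convex combination C of relatively weakly open subsets of B_{C_0(K,X)}, every x ∈ C with ‖x‖ < 1 is an interior point of C in the relative weak topology of B_{C_0(K,X)}. -/

import Mathlib

open Metric Topology

/-- The weak topology on a normed space `E` over `𝕜`. -/
def weakTop (𝕜 E : Type*) [NontriviallyNormedField 𝕜] [NormedAddCommGroup E]
    [NormedSpace 𝕜 E] : TopologicalSpace E :=
  TopologicalSpace.induced (fun (x : E) (f : E →L[𝕜] 𝕜) => f x) inferInstance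

/-- `U` is a relatively weakly open subset of the closed unit ball of `E`. -/
def RelWeakOpen (𝕜 : Type*) {E : Type*} [NontriviallyNormedField 𝕜] [NormedAddCommGroup E]
    [NormedSpace 𝕜 E] (U : Set E) : Prop :=
  U ⊆ closedBall 0 1 ∧ ∃ V : Set E, IsOpen[weakTop 𝕜 E] V ∧ U = V ∩ closedBall 0 1

/-- `x` is an interior point of `C` in the relative weak topology of the closed
unit ball of `E`. -/
def RelWeakInterior (𝕜 : Type*) {E : Type*} [NontriviallyNormedField 𝕜] [NormedAddCommGroup E]
    [NormedSpace 𝕜 E] (C : Set E) (x : E) : Prop :=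
  ∃ V : Set E, IsOpen[weakTop 𝕜 E] V ∧ x ∈ V ∧ V ∩ closedBall 0 1 ⊆ C

/-- The convex combination `∑ j, lam j • U j` of the sets `U j` with coefficients `lam j`. -/
def ConvComb (𝕜 : Type*) {E : Type*} [RCLike 𝕜] [NormedAddCommGroup E] [NormedSpace 𝕜 E]
    {n : ℕ} (lam : Fin n → ℝ) (U : Fin n → Set E) : Set E :=
  {x | ∃ u : Fin n → E, (∀ j, u j ∈ U j) ∧ x = ∑ j, ((lam j : ℝ) : 𝕜) • u j}

/-- `X` has property CWO. -/
def PropCWO (𝕜 E : Type*) [RCLike 𝕜] [NormedAddCommGroup E] [NormedSpace 𝕜 E] : Prop :=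
  ∀ (n : ℕ) (U : Fin n → Set E) (lam : Fin n → ℝ),
    (∀ j, RelWeakOpen 𝕜 (U j)) → (∀ j, 0 < lam j) → (∑ j, lam j) = 1 →
    ∃ V : Set E, IsOpen[weakTop 𝕜 E] V ∧ ConvComb 𝕜 lam U = V ∩ closedBall 0 1

/-- `X` has property CWO-S. -/
def PropCWOS (𝕜 E : Type*) [RCLike 𝕜] [NormedAddCommGroup E] [NormedSpace 𝕜 E] : Prop :=
  ∀ (n : ℕ) (U : Fin n → Set E) (lam : Fin n → ℝ),
    (∀ j, RelWeakOpen 𝕜 (U j)) → (∀ j, 0 < lam j) → (∑ j, lam j) = 1 →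
    ∀ x ∈ ConvComb 𝕜 lam U, ‖x‖ = 1 → RelWeakInterior 𝕜 (ConvComb 𝕜 lam U) x

/-- `X` has property CWO-B. -/
def PropCWOB (𝕜 E : Type*) [RCLike 𝕜] [NormedAddCommGroup E] [NormedSpace 𝕜 E] : Prop :=
  ∀ (n : ℕ) (U : Fin n → Set E) (lam : Fin n → ℝ),
    (∀ j, RelWeakOpen 𝕜 (U j)) → (∀ j, 0 < lam j) → (∑ j, lam j) = 1 →
    ∀ x ∈ ConvComb 𝕜 lam U, ‖x‖ < 1 → RelWeakInterior 𝕜 (ConvComb 𝕜 lam U) x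

/-- A point `x` of the closed unit ball has property (co n). -/
def HasCoN (𝕜 : Type*) {E : Type*} [RCLike 𝕜] [NormedAddCommGroup E] [NormedSpace 𝕜 E]
    (n : ℕ) (x : E) : Prop :=
  ∀ (xs : Fin n → E) (lam : Fin n → ℝ),
    (∀ j, ‖xs j‖ ≤ 1) → (∀ j, 0 < lam j) → (∑ j, lam j) = 1 →
    x = (∑ j, ((lam j : ℝ) : 𝕜) • xs j) →
    ∀ ε : ℝ, 0 < ε → ∃ δ : ℝ, 0 < δ ∧
      ∃ v : Fin n → ((ball x δ ∩ closedBall 0 1 : Set E) → E),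
        (∀ j, Continuous (v j)) ∧
        ∀ u : (ball x δ ∩ closedBall 0 1 : Set E),
          (∀ j, ‖v j u‖ ≤ 1) ∧
          (u : E) = (∑ j, ((lam j : ℝ) : 𝕜) • v j u) ∧
          ∀ j, ‖v j u - xs j‖ < ε

/-- A point `x` of the closed unit ball has property (co). -/
def HasCoPt (𝕜 : Type*) {E : Type*} [RCLike 𝕜] [NormedAddCommGroup E] [NormedSpace 𝕜 E]
    (x : E) : Prop :=
  ∀ n : ℕ, 2 ≤ n → HasCoN 𝕜 n x

/-- The space has property (co). -/
def PropCo (𝕜 E : Type*) [RCLike 𝕜] [NormedAddCommGroup E] [NormedSpace 𝕜 E] : Prop :=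
  ∀ x : E, ‖x‖ ≤ 1 → HasCoPt 𝕜 x

/-- `x` is an extreme point of the closed unit ball of `E`
(with respect to the real convex structure). -/
def IsExtremePt (𝕜 : Type*) {E : Type*} [RCLike 𝕜] [NormedAddCommGroup E] [NormedSpace 𝕜 E]
    (x : E) : Prop :=
  ‖x‖ ≤ 1 ∧ ∀ y z : E, ‖y‖ ≤ 1 → ‖z‖ ≤ 1 → ∀ t : ℝ, 0 < t → t < 1 →
    x = ((t : ℝ) : 𝕜) • y + (((1 - t : ℝ) : ℝ) : 𝕜) • z → y = x ∧ z = x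

/-- A topological space is scattered if every non-empty subset `A` has a point
isolated in `A`. -/
def Scattered (K : Type*) [TopologicalSpace K] : Prop :=
  ∀ A : Set K, A.Nonempty → ∃ a ∈ A, ∃ U : Set K, IsOpen U ∧ U ∩ A = {a}


section Helpers

open ZeroAtInfty Filter

variable {𝕜 K X : Type*} [RCLike 𝕜] [TopologicalSpace K]
  [NormedAddCommGroup X] [NormedSpace 𝕜 X]

theorem c0_norm_le {z : C₀(K, X)} {C : ℝ} (hC : 0 ≤ C) : ‖z‖ ≤ C ↔ ∀ s, ‖z s‖ ≤ C := by
  rw [← ZeroAtInftyContinuousMap.norm_toBCF_eq_norm, BoundedContinuousFunction.norm_le hC]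
  rfl

theorem c0_apply_le (z : C₀(K, X)) (s : K) : ‖z s‖ ≤ ‖z‖ :=
  (c0_norm_le (norm_nonneg z)).1 le_rfl s

theorem c0_exists (z : C₀(K, X)) (g : K → X) (hg : Continuous g)
    (h : ∀ s, ‖g s‖ ≤ ‖z s‖) : ∃ w : C₀(K, X), ∀ s, w s = g s := by
  refine ⟨⟨⟨g, hg⟩, ?_⟩, fun s => rfl⟩
  refine squeeze_zero_norm h ?_
  simpa using z.zero_at_infty'.norm

theorem c0_mul (𝕜 : Type*) [RCLike 𝕜] [NormedSpace 𝕜 X] (φ : C(K, ℝ))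
    (hφ : ∀ s, φ s ∈ Set.Icc (0 : ℝ) 1) (z : C₀(K, X)) :
    ∃ w : C₀(K, X), (∀ s, w s = ((φ s : ℝ) : 𝕜) • z s) ∧ ‖w‖ ≤ ‖z‖ := by
  have hb : ∀ s, ‖((φ s : ℝ) : 𝕜) • z s‖ ≤ ‖z s‖ := by
    intro s
    rw [norm_smul, RCLike.norm_ofReal, abs_of_nonneg (hφ s).1]
    exact mul_le_of_le_one_left (norm_nonneg _) (hφ s).2
  have hc : Continuous fun s => ((φ s : ℝ) : 𝕜) • z s :=
    (RCLike.continuous_ofReal.comp φ.continuous).smul z.continuous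
  obtain ⟨w, hw⟩ := c0_exists z _ hc hb
  refine ⟨w, hw, (c0_norm_le (norm_nonneg _)).2 fun s => ?_⟩
  rw [hw]
  exact (hb s).trans (c0_apply_le z s)

theorem c0_trunc (𝕜 : Type*) [RCLike 𝕜] [NormedSpace 𝕜 X] (z : C₀(K, X)) {δ : ℝ} (hδ : 0 < δ) :
    ∃ w : C₀(K, X), ‖w‖ ≤ ‖z‖ ∧ ‖z - w‖ ≤ δ ∧ ∀ s, ‖z s‖ ≤ δ → w s = 0 := by
  have hm : ∀ s, 0 < max ‖z s‖ δ := fun s => lt_max_of_lt_right hδ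
  have hcz : Continuous fun s => z s := z.continuous
  let φ : C(K, ℝ) := ⟨fun s => 1 - δ / max ‖z s‖ δ,
    continuous_const.sub (continuous_const.div (hcz.norm.max continuous_const)
      fun s => (hm s).ne')⟩
  have hle : ∀ s, δ / max ‖z s‖ δ ≤ 1 := fun s => (div_le_one (hm s)).2 (le_max_right _ _)
  have hpos : ∀ s, 0 ≤ δ / max ‖z s‖ δ := fun s => (div_pos hδ (hm s)).le
  obtain ⟨w, hw, hwn⟩ := c0_mul 𝕜 φ (fun s => ⟨sub_nonneg.2 (hle s), by
    have := hpos s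
    change 1 - δ / max ‖z s‖ δ ≤ 1
    linarith⟩) z
  refine ⟨w, hwn, (c0_norm_le hδ.le).2 fun s => ?_, fun s hs => ?_⟩
  · have : (z - w) s = ((δ / max ‖z s‖ δ : ℝ) : 𝕜) • z s := by
      rw [ZeroAtInftyContinuousMap.sub_apply, hw]
      change z s - ((1 - δ / max ‖z s‖ δ : ℝ) : 𝕜) • z s = _
      rw [RCLike.ofReal_sub, sub_smul]
      simp
    rw [this, norm_smul, RCLike.norm_ofReal, abs_of_nonneg (hpos s), div_mul_eq_mul_div,
      div_le_iff₀ (hm s)]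
    exact mul_le_mul_of_nonneg_left (le_max_left _ _) hδ.le
  · rw [hw]
    change ((1 - δ / max ‖z s‖ δ : ℝ) : 𝕜) • z s = 0
    rw [max_eq_right hs, div_self hδ.ne']
    simp

theorem c0_level_compact (z : C₀(K, X)) {δ : ℝ} (hδ : 0 < δ) : IsCompact {s | δ ≤ ‖z s‖} := by
  have hcz : Continuous fun s => z s := z.continuous
  have h0 : Tendsto (fun s => ‖z s‖) (cocompact K) (𝓝 0) := by
    simpa using z.zero_at_infty'.norm
  have h1 := h0.eventually (gt_mem_nhds hδ)
  obtain ⟨t, ht, hts⟩ := mem_cocompact.1 h1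
  refine ht.of_isClosed_subset (isClosed_le continuous_const hcz.norm) fun s hs => ?_
  by_contra hst
  have := hts hst
  simp only [Set.mem_ofPred_eq] at this hs
  linarith

/-- Evaluation at a point. -/
noncomputable def c0_eval (𝕜 : Type*) [RCLike 𝕜] [NormedSpace 𝕜 X] (s : K) : C₀(K, X) →L[𝕜] X :=
  LinearMap.mkContinuous
    { toFun := fun y => y s
      map_add' := fun _ _ => rfl
      map_smul' := fun _ _ => rfl } 1 fun y => by
    rw [one_mul]
    exact c0_apply_le y s

theorem c0_eval_apply (s : K) (y : C₀(K, X)) : c0_eval 𝕜 s y = y s := rfl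

/-- The functional `f` is small on functions living on `V` and vanishing on a finite set. -/
def FinP (f : C₀(K, X) →L[𝕜] 𝕜) (V : Set K) : Prop :=
  ∀ ε : ℝ, 0 < ε → ∃ F : Set K, F.Finite ∧ ∀ z : C₀(K, X), ‖z‖ ≤ 1 →
    (∀ s, s ∉ V → z s = 0) → (∀ s ∈ F, z s = 0) → ‖f z‖ ≤ ε

theorem c0_regular (f : C₀(K, X) →L[𝕜] 𝕜) (V : Set K) {ε : ℝ} (hε : 0 < ε) :
    ∃ L : Set K, IsCompact L ∧ L ⊆ V ∧ ∀ w : C₀(K, X), ‖w‖ ≤ 1 →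
      (∀ s, s ∉ V → w s = 0) → (∀ s ∈ L, w s = 0) → ‖f w‖ ≤ ε := by
  set A : Set ℝ := {r | ∃ z : C₀(K, X), ‖z‖ ≤ 1 ∧ (∀ s, s ∉ V → z s = 0) ∧ r = ‖f z‖} with hA
  have hne : A.Nonempty := ⟨_, 0, by simp, by simp, rfl⟩
  have hbdd : BddAbove A := by
    refine ⟨‖f‖, ?_⟩
    rintro r ⟨z, hz, -, rfl⟩
    exact f.unit_le_opNorm z hz
  obtain ⟨r, ⟨z, hz, hzV, rfl⟩, hr⟩ := exists_lt_of_lt_csSup hne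
    (show sSup A - ε / 2 < sSup A by linarith)
  have hf1 : 0 < ‖f‖ + 1 := by positivity
  have hδ : 0 < ε / (2 * (‖f‖ + 1)) := by positivity
  set δ := ε / (2 * (‖f‖ + 1)) with hδdef
  obtain ⟨z1, hz1, hzz1, hz10⟩ := c0_trunc 𝕜 z hδ
  refine ⟨{s | δ ≤ ‖z s‖}, c0_level_compact z hδ, ?_, ?_⟩
  · intro s hs
    by_contra hsV
    simp only [Set.mem_ofPred_eq, hzV s hsV, norm_zero] at hs
    linarith
  · intro w hw hwV hwL
    obtain ⟨c, hc, hcz⟩ := RCLike.exists_norm_eq_mul_self (f z1)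
    obtain ⟨d, hd, hdw⟩ := RCLike.exists_norm_eq_mul_self (f w)
    have hmem : ‖f (c • z1 + d • w)‖ ∈ A := by
      refine ⟨_, (c0_norm_le zero_le_one).2 fun s => ?_, fun s hs => ?_, rfl⟩
      · simp only [ZeroAtInftyContinuousMap.add_apply, ZeroAtInftyContinuousMap.smul_apply]
        by_cases hs : δ ≤ ‖z s‖
        · rw [hwL s hs, smul_zero, add_zero, norm_smul, hc, one_mul]
          exact (c0_apply_le z1 s).trans (hz1.trans hz)
        · rw [hz10 s (not_le.1 hs).le, smul_zero, zero_add, norm_smul, hd, one_mul]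
          exact (c0_apply_le w s).trans hw
      · have : z1 s = 0 := hz10 s (by rw [hzV s hs, norm_zero]; exact hδ.le)
        simp [this, hwV s hs]
    have h1 := le_csSup hbdd hmem
    have h2 : f (c • z1 + d • w) = ((‖f z1‖ + ‖f w‖ : ℝ) : 𝕜) := by
      rw [map_add, map_smul, map_smul, smul_eq_mul, smul_eq_mul, ← hcz, ← hdw]
      push_cast
      rfl
    rw [h2, RCLike.norm_ofReal, abs_of_nonneg (by positivity)] at h1
    have h3 : ‖f z‖ ≤ ‖f z1‖ + ε / 2 := by
      have e : f z = f z1 + f (z - z1) := by rw [← map_add]; congr 1; abel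
      have h4 : ‖f (z - z1)‖ ≤ ε / 2 := by
        calc ‖f (z - z1)‖ ≤ ‖f‖ * ‖z - z1‖ := f.le_opNorm _
          _ ≤ (‖f‖ + 1) * δ := by gcongr; linarith
          _ = ε / 2 := by rw [hδdef]; field_simp
      rw [e]
      exact (norm_add_le _ _).trans (by linarith)
    linarith

variable [LocallyCompactSpace K] [T2Space K]

theorem finP_compact (f : C₀(K, X) →L[𝕜] 𝕜) (S : Set (Set K))
    (hS : ∀ V ∈ S, IsOpen V ∧ FinP f V) (L : Set K) (hL : IsCompact L) (hLS : L ⊆ ⋃₀ S) :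
    ∀ ε : ℝ, 0 < ε → ∃ F : Set K, F.Finite ∧ ∃ φ : C(K, ℝ), (∀ s, φ s ∈ Set.Icc (0 : ℝ) 1) ∧
      (∀ s ∈ L, φ s = 1) ∧ ∀ z w : C₀(K, X), ‖z‖ ≤ 1 → (∀ s ∈ F, z s = 0) →
        (∀ s, w s = ((φ s : ℝ) : 𝕜) • z s) → ‖f w‖ ≤ ε := by
  refine hL.induction_on (p := fun L => ∀ ε : ℝ, 0 < ε → ∃ F : Set K, F.Finite ∧ ∃ φ : C(K, ℝ),
      (∀ s, φ s ∈ Set.Icc (0 : ℝ) 1) ∧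
      (∀ s ∈ L, φ s = 1) ∧ ∀ z w : C₀(K, X), ‖z‖ ≤ 1 → (∀ s ∈ F, z s = 0) →
        (∀ s, w s = ((φ s : ℝ) : 𝕜) • z s) → ‖f w‖ ≤ ε) ?_ ?_ ?_ ?_
  · intro ε hε
    refine ⟨∅, Set.finite_empty, 0, by simp, by simp, ?_⟩
    intro z w _ _ hw
    have : w = 0 := by ext s; simp [hw]
    simp [this, hε.le]
  · intro s t hst ht ε hε
    obtain ⟨F, hF, φ, h1, h2, h3⟩ := ht ε hε
    exact ⟨F, hF, φ, h1, fun x hx => h2 x (hst hx), h3⟩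
  · intro s t hs ht ε hε
    obtain ⟨F, hF, φ, h1, h2, h3⟩ := hs (ε / 2) (by linarith)
    obtain ⟨G, hG, ψ, k1, k2, k3⟩ := ht (ε / 2) (by linarith)
    refine ⟨F ∪ G, hF.union hG, φ + ψ * (1 - φ), ?_, ?_, ?_⟩
    · intro x
      obtain ⟨a1, a2⟩ := h1 x
      obtain ⟨b1, b2⟩ := k1 x
      simp only [ContinuousMap.add_apply, ContinuousMap.mul_apply, ContinuousMap.sub_apply,
        ContinuousMap.one_apply]
      constructor <;> nlinarith
    · rintro x (hx | hx)
      · simp [h2 x hx]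
      · simp [k2 x hx]
    · intro z w hz hzF hw
      obtain ⟨u, hu, hun⟩ := c0_mul 𝕜 φ h1 z
      obtain ⟨v, hv, hvn⟩ := c0_mul 𝕜 (1 - φ) (fun x => by
        obtain ⟨a1, a2⟩ := h1 x
        simp only [ContinuousMap.sub_apply, ContinuousMap.one_apply]
        constructor <;> linarith) z
      obtain ⟨v', hv', -⟩ := c0_mul 𝕜 ψ k1 v
      have e : w = u + v' := by
        ext x
        rw [ZeroAtInftyContinuousMap.add_apply, hw, hu, hv', hv, smul_smul, ← add_smul]
        congr 1
        simp
      have i1 := h3 z u hz (fun x hx => hzF x (Or.inl hx)) hu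
      have i2 := k3 v v' (hvn.trans hz) (fun x hx => by
        rw [hv, hzF x (Or.inr hx), smul_zero]) hv'
      rw [e, map_add]
      exact (norm_add_le _ _).trans (by linarith)
  · intro x hx
    obtain ⟨V, hVS, hxV⟩ := hLS hx
    obtain ⟨hVo, hVP⟩ := hS V hVS
    obtain ⟨C, hC, hxC, hCV⟩ := exists_compact_subset hVo hxV
    refine ⟨C, mem_nhdsWithin_of_mem_nhds (mem_interior_iff_mem_nhds.1 hxC), ?_⟩
    intro ε hε
    obtain ⟨F, hF, hFz⟩ := hVP ε hε
    obtain ⟨φ, hφ1, hφ0, -, hφ⟩ := exists_continuous_one_zero_of_isCompact hC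
      hVo.isClosed_compl (Set.disjoint_compl_right_iff_subset.2 hCV)
    refine ⟨F, hF, φ, hφ, fun s hs => hφ1 hs, fun z w hz hzF hw => ?_⟩
    refine hFz w ((c0_norm_le zero_le_one).2 fun s => ?_) (fun s hs => ?_) (fun s hs => ?_)
    · rw [hw, norm_smul, RCLike.norm_ofReal, abs_of_nonneg (hφ s).1]
      exact mul_le_one₀ (hφ s).2 (norm_nonneg _) ((c0_apply_le z s).trans hz)
    · rw [hw, hφ0 hs]; simp
    · rw [hw, hzF s hs, smul_zero]

theorem finP_sUnion (f : C₀(K, X) →L[𝕜] 𝕜) (S : Set (Set K))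
    (hS : ∀ V ∈ S, IsOpen V ∧ FinP f V) : FinP f (⋃₀ S) := by
  intro ε hε
  obtain ⟨L, hL, hLS, hreg⟩ := c0_regular f (⋃₀ S) (half_pos hε)
  obtain ⟨F, hF, φ, h1, h2, h3⟩ := finP_compact f S hS L hL hLS (ε / 2) (half_pos hε)
  refine ⟨F, hF, fun z hz hzS hzF => ?_⟩
  obtain ⟨u, hu, hun⟩ := c0_mul 𝕜 φ h1 z
  obtain ⟨v, hv, hvn⟩ := c0_mul 𝕜 (1 - φ) (fun x => by
    obtain ⟨a1, a2⟩ := h1 x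
    simp only [ContinuousMap.sub_apply, ContinuousMap.one_apply]
    constructor <;> linarith) z
  have e : z = u + v := by
    ext x
    rw [ZeroAtInftyContinuousMap.add_apply, hu, hv, ← add_smul]
    simp
  have i1 := h3 z u hz hzF hu
  have i2 := hreg v (hvn.trans hz) (fun s hs => by rw [hv, hzS s hs, smul_zero])
    (fun s hs => by rw [hv]; simp [h2 s hs])
  rw [e, map_add]
  exact (norm_add_le _ _).trans (by linarith)

theorem finP_univ (hK : Scattered K) (f : C₀(K, X) →L[𝕜] 𝕜) : FinP f Set.univ := by
  set S : Set (Set K) := {V | IsOpen V ∧ FinP f V} with hSdef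
  have hP : FinP f (⋃₀ S) := finP_sUnion f S fun V hV => hV
  have hO : IsOpen (⋃₀ S) := isOpen_sUnion fun V hV => hV.1
  by_cases hne : ((⋃₀ S)ᶜ : Set K).Nonempty
  · exfalso
    obtain ⟨a, ha, U, hU, hUa⟩ := hK _ hne
    have haU : a ∈ U := by
      have : a ∈ U ∩ (⋃₀ S)ᶜ := by rw [hUa]; rfl
      exact this.1
    refine ha (Set.mem_sUnion.2 ⟨U ∪ ⋃₀ S, ⟨hU.union hO, ?_⟩, Or.inl haU⟩)
    intro ε hε
    obtain ⟨F, hF, h⟩ := hP ε hε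
    refine ⟨insert a F, hF.insert a, fun z hz hzV hzF => h z hz (fun s hs => ?_)
      fun s hs => hzF s (Or.inr hs)⟩
    by_cases hsU : s ∈ U
    · have : s ∈ ({a} : Set K) := by rw [← hUa]; exact ⟨hsU, hs⟩
      exact hzF s (Or.inl this)
    · exact hzV s (by rintro (h | h); exacts [hsU h, hs h])
  · rw [Set.not_nonempty_iff_eq_empty, Set.compl_empty_iff] at hne
    rwa [hne] at hP

theorem functional_small (hK : Scattered K) (f : C₀(K, X) →L[𝕜] 𝕜) {ε : ℝ} (hε : 0 < ε) :
    ∃ F : Set K, F.Finite ∧ ∃ δ : ℝ, 0 < δ ∧ ∀ z : C₀(K, X), ‖z‖ ≤ 2 →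
      (∀ s ∈ F, ‖z s‖ < δ) → ‖f z‖ < ε := by
  obtain ⟨F, hF, h⟩ := finP_univ hK f (ε / 8) (by linarith)
  have hδ : 0 < ε / (2 * (‖f‖ + 1)) := by positivity
  refine ⟨F, hF, _, hδ, fun z hz hzF => ?_⟩
  obtain ⟨w, hw, hzw, hw0⟩ := c0_trunc 𝕜 z hδ
  have h1 : ‖f ((2⁻¹ : 𝕜) • w)‖ ≤ ε / 8 := by
    refine h _ ?_ (fun s hs => (hs trivial).elim) fun s hs => ?_
    · rw [norm_smul, norm_inv, RCLike.norm_ofNat]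
      linarith
    · rw [ZeroAtInftyContinuousMap.smul_apply, hw0 s (hzF s hs).le, smul_zero]
  rw [map_smul, norm_smul, norm_inv, RCLike.norm_ofNat] at h1
  have h4 : ‖f (z - w)‖ ≤ ε / 2 := by
    calc ‖f (z - w)‖ ≤ ‖f‖ * ‖z - w‖ := f.le_opNorm _
      _ ≤ (‖f‖ + 1) * (ε / (2 * (‖f‖ + 1))) := by gcongr; linarith
      _ = ε / 2 := by field_simp
  have e : f z = f w + f (z - w) := by rw [← map_add]; congr 1; abel
  rw [e]
  exact (norm_add_le _ _).trans_lt (by linarith)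

theorem weak_nhd (hK : Scattered K) (V : Set C₀(K, X)) (hV : IsOpen[weakTop 𝕜 C₀(K, X)] V)
    (u : C₀(K, X)) (hu : u ∈ V) (hu1 : ‖u‖ ≤ 1) :
    ∃ F : Set K, F.Finite ∧ ∃ δ : ℝ, 0 < δ ∧ ∀ y : C₀(K, X), ‖y‖ ≤ 1 →
      (∀ s ∈ F, ‖y s - u s‖ < δ) → y ∈ V := by
  obtain ⟨W, hW, rfl⟩ := isOpen_induced_iff.1 hV
  obtain ⟨I, O, hO, hsubset⟩ := isOpen_pi_iff.1 hW _ hu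
  have key : ∀ f : C₀(K, X) →L[𝕜] 𝕜, ∃ F : Set K, F.Finite ∧ ∃ δ : ℝ, 0 < δ ∧
      (f ∈ I → ∀ y : C₀(K, X), ‖y‖ ≤ 1 → (∀ s ∈ F, ‖y s - u s‖ < δ) → f y ∈ O f) := by
    intro f
    by_cases hf : f ∈ I
    · obtain ⟨hOf, huf⟩ := hO f hf
      obtain ⟨ε, hε, hball⟩ := Metric.isOpen_iff.1 hOf _ huf
      obtain ⟨F, hF, δ, hδ, h⟩ := functional_small hK f hε
      refine ⟨F, hF, δ, hδ, fun _ y hy hyF => hball ?_⟩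
      rw [mem_ball, dist_eq_norm, ← map_sub]
      exact h _ ((norm_sub_le _ _).trans (by linarith)) hyF
    · exact ⟨∅, Set.finite_empty, 1, one_pos, fun h => (hf h).elim⟩
  choose F hF δ hδ h using key
  have hev : ∀ᶠ r in 𝓝[>] (0 : ℝ), ∀ f ∈ I, r ≤ δ f := by
    rw [Filter.eventually_all_finset]
    intro f _
    exact mem_nhdsWithin_of_mem_nhds (Iic_mem_nhds (hδ f))
  obtain ⟨r, hr, hr0⟩ := (hev.and self_mem_nhdsWithin).exists
  refine ⟨⋃ f ∈ I, F f, I.finite_toSet.biUnion fun f _ => hF f, r, hr0, fun y hy hyF => ?_⟩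
  refine hsubset fun f hf => h f hf y hy fun s hs => ?_
  exact (hyF s (Set.mem_biUnion hf hs)).trans_le (hr f hf)

theorem weak_open_pt [FiniteDimensional 𝕜 X] (x : C₀(K, X)) (F : Set K) (hF : F.Finite) (δ : ℝ) :
    IsOpen[weakTop 𝕜 C₀(K, X)] {y | ∀ s ∈ F, ‖y s - x s‖ < δ} := by
  let b := Module.finBasis 𝕜 X
  let l : K → Fin (Module.finrank 𝕜 X) → (C₀(K, X) →L[𝕜] 𝕜) := fun s i =>
    (LinearMap.toContinuousLinearMap (b.coord i)).comp (c0_eval 𝕜 s)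
  let g : K → ((C₀(K, X) →L[𝕜] 𝕜) → 𝕜) → X := fun s p => ∑ i, p (l s i) • b i
  have hg : ∀ s, Continuous (g s) := fun s =>
    continuous_finsetSum _ fun i _ => (continuous_apply (l s i)).smul continuous_const
  have hgy : ∀ s (y : C₀(K, X)), g s (fun f => f y) = y s := fun s y => b.sum_repr (y s)
  refine isOpen_induced_iff.2 ⟨⋂ s ∈ F, {p | ‖g s p - x s‖ < δ}, ?_, ?_⟩
  · exact hF.isOpen_biInter fun s _ =>
      isOpen_lt ((hg s).sub continuous_const).norm continuous_const
  · ext y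
    simp [hgy]

end Helpers

open ZeroAtInfty in
/-- For `K` scattered locally compact Hausdorff and `X` finite dimensional,
`C₀(K, X)` has property CWO-B. -/
theorem stmt4 {𝕜 K X : Type*} [RCLike 𝕜] [TopologicalSpace K] [LocallyCompactSpace K]
    [T2Space K] [NormedAddCommGroup X] [NormedSpace 𝕜 X] [FiniteDimensional 𝕜 X]
    (hK : Scattered K) :
    PropCWOB 𝕜 C₀(K, X) := by
  intro n U lam hU hlam hsum x hx hx1
  obtain ⟨u, huU, hxu⟩ := hx
  have key : ∀ j, ∃ F : Set K, F.Finite ∧ ∃ δ : ℝ, 0 < δ ∧ ∀ y : C₀(K, X), ‖y‖ ≤ 1 →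
      (∀ s ∈ F, ‖y s - u j s‖ < δ) → y ∈ U j := by
    intro j
    obtain ⟨-, V, hV, hUV⟩ := hU j
    have hj := huU j
    rw [hUV] at hj
    obtain ⟨F, hF, δ, hδ, h⟩ := weak_nhd hK V hV (u j) hj.1 (mem_closedBall_zero_iff.1 hj.2)
    exact ⟨F, hF, δ, hδ, fun y hy hyF => by
      rw [hUV]; exact ⟨h y hy hyF, mem_closedBall_zero_iff.2 hy⟩⟩
  choose F hF δ hδ h using key
  have hev : ∀ᶠ r in 𝓝[>] (0 : ℝ), ∀ j, r ≤ δ j := by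
    rw [Filter.eventually_all]
    intro j
    exact mem_nhdsWithin_of_mem_nhds (Iic_mem_nhds (hδ j))
  have hev2 : ∀ᶠ r in 𝓝[>] (0 : ℝ), r ≤ 1 :=
    mem_nhdsWithin_of_mem_nhds (Iic_mem_nhds one_pos)
  obtain ⟨r, ⟨hr, hr1⟩, hr0⟩ := ((hev.and hev2).and self_mem_nhdsWithin).exists
  replace hr0 : 0 < r := hr0
  have hun : ∀ j, ‖u j‖ ≤ 1 := fun j => mem_closedBall_zero_iff.1 ((hU j).1 (huU j))
  set η := r / 8 with hη
  have hη0 : 0 < η := by positivity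
  set ρ := min (r / 2) (η * (1 - ‖x‖)) with hρ
  have hρ0 : 0 < ρ := lt_min (by linarith) (mul_pos hη0 (by linarith))
  have hρ1 : ρ ≤ r / 2 := min_le_left _ _
  have hρ2 : ρ ≤ η * (1 - ‖x‖) := min_le_right _ _
  set G : Set K := ⋃ j, F j with hG
  have hGf : G.Finite := Set.finite_iUnion hF
  refine ⟨_, weak_open_pt (𝕜 := 𝕜) x G hGf ρ, fun s _ => by simpa using hρ0, ?_⟩
  rintro y ⟨hyG, hy⟩
  rw [mem_closedBall_zero_iff] at hy
  have hcy : Continuous fun s => y s := y.continuous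
  have hcx : Continuous fun s => x s := x.continuous
  have hOpen : IsOpen {s | ‖y s - x s‖ < ρ} := isOpen_lt (hcy.sub hcx).norm continuous_const
  obtain ⟨φ, hφ1, hφ0, -, hφ⟩ := exists_continuous_one_zero_of_isCompact hGf.isCompact
      hOpen.isClosed_compl (Set.disjoint_compl_right_iff_subset.2 fun s hs => hyG s hs)
  have hd : ∀ j, ∃ w : C₀(K, X), (∀ s, w s = ((φ s : ℝ) : 𝕜) •
      ((((1 - η : ℝ) : 𝕜) • (u j - x)) s)) ∧ ‖w‖ ≤ ‖((1 - η : ℝ) : 𝕜) • (u j - x)‖ :=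
    fun j => c0_mul 𝕜 φ hφ _
  choose w hw _ using hd
  refine ⟨fun j => y + w j, fun j => h j _ ?_ ?_, ?_⟩
  · refine (c0_norm_le zero_le_one).2 fun s => ?_
    rw [ZeroAtInftyContinuousMap.add_apply, hw]
    by_cases hs : ‖y s - x s‖ < ρ
    · set q : X := ((1 - η : ℝ) : 𝕜) • u j s + ((η : ℝ) : 𝕜) • x s + (y s - x s) with hq
      have e : y s + ((φ s : ℝ) : 𝕜) • ((((1 - η : ℝ) : 𝕜) • (u j - x)) s)
          = ((1 - φ s : ℝ) : 𝕜) • y s + ((φ s : ℝ) : 𝕜) • q := by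
        rw [hq, ZeroAtInftyContinuousMap.smul_apply, ZeroAtInftyContinuousMap.sub_apply]
        push_cast
        module
      have hqn : ‖q‖ ≤ 1 := by
        have a1 : ‖((1 - η : ℝ) : 𝕜) • u j s‖ ≤ 1 - η := by
          rw [norm_smul, RCLike.norm_ofReal, abs_of_nonneg (by linarith)]
          exact mul_le_of_le_one_right (by linarith) ((c0_apply_le _ s).trans (hun j))
        have a2 : ‖((η : ℝ) : 𝕜) • x s‖ ≤ η * ‖x‖ := by
          rw [norm_smul, RCLike.norm_ofReal, abs_of_nonneg hη0.le]
          exact mul_le_mul_of_nonneg_left (c0_apply_le _ s) hη0.le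
        rw [hq]
        refine (norm_add₃_le).trans ?_
        nlinarith
      rw [e]
      refine (norm_add_le _ _).trans ?_
      obtain ⟨b1, b2⟩ := hφ s
      rw [norm_smul, norm_smul, RCLike.norm_ofReal, RCLike.norm_ofReal, abs_of_nonneg b1,
        abs_of_nonneg (by linarith : 0 ≤ 1 - φ s)]
      have := (c0_apply_le y s).trans hy
      nlinarith
    · rw [hφ0 hs]
      simpa using (c0_apply_le y s).trans hy
  · intro s hs
    have hsG : s ∈ G := Set.mem_iUnion.2 ⟨j, hs⟩
    rw [ZeroAtInftyContinuousMap.add_apply, hw, hφ1 hsG]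
    have e : y s + ((((1 : K → ℝ) s : ℝ)) : 𝕜) • ((((1 - η : ℝ) : 𝕜) • (u j - x)) s) - u j s
        = (y s - x s) + ((η : ℝ) : 𝕜) • (x s - u j s) := by
      rw [ZeroAtInftyContinuousMap.smul_apply, ZeroAtInftyContinuousMap.sub_apply, Pi.one_apply]
      push_cast
      module
    rw [e]
    refine (norm_add_le _ _).trans_lt ?_
    have a1 := hyG s hsG
    have a2 : ‖((η : ℝ) : 𝕜) • (x s - u j s)‖ ≤ η * 2 := by
      rw [norm_smul, RCLike.norm_ofReal, abs_of_nonneg hη0.le]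
      refine mul_le_mul_of_nonneg_left ((norm_sub_le _ _).trans ?_) hη0.le
      have := c0_apply_le x s
      have := (c0_apply_le (u j) s).trans (hun j)
      linarith
    have := hr j
    linarith
  · have hs1 : ∑ j, ((lam j : ℝ) : 𝕜) = 1 := by
      rw [← RCLike.ofReal_sum, hsum, RCLike.ofReal_one]
    have hz : ∑ j, ((lam j : ℝ) : 𝕜) • w j = 0 := by
      have hcomb : ∑ j, ((lam j : ℝ) : 𝕜) • (((1 - η : ℝ) : 𝕜) • (u j - x)) = 0 := by
        simp_rw [smul_comm _ (((1 - η : ℝ) : 𝕜))]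
        rw [← Finset.smul_sum]
        simp_rw [smul_sub]
        rw [Finset.sum_sub_distrib, ← hxu, ← Finset.sum_smul, hs1, one_smul, sub_self, smul_zero]
      ext s
      have e1 := congrArg (c0_eval 𝕜 s) hcomb
      rw [← c0_eval_apply (𝕜 := 𝕜) s]
      simp only [map_sum, map_smul, map_zero, c0_eval_apply, hw,
        ZeroAtInftyContinuousMap.zero_apply, ZeroAtInftyContinuousMap.smul_apply,
        ZeroAtInftyContinuousMap.sub_apply] at e1 ⊢
      simp_rw [smul_comm (_ : 𝕜) (((φ s : ℝ) : 𝕜))]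
      rw [← Finset.smul_sum, e1, smul_zero]
    simp_rw [smul_add]
    rw [Finset.sum_add_distrib, ← Finset.sum_smul, hs1, one_smul, hz, add_zero]
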